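/- arXiv:1605.01021 — 2 statements merged into one kernel-verified Lean document; each statement's English description precedes it below -/
import Mathlib

section
/- Strict data processing inequality for f-mutual information (Theorem 3.4, strict part): Let Σ_X, Σ_Y be finite sets, let P be a joint pmf on Σ_X × Σ_Y that is fine-grained, let M be a square transition matrix from Σ_X to Σ_X that is not a permutation matrix, and let f : ℝ → ℝ be strictly convex with f(1) = 0. Assume P, the pushforward M(P), and all of their marginals are strictly positive. Then MI_f(M(P)) < MI_f(P). -/
/-- The f-mutual information of a joint pmf `P` on `X × Y`:
`MI_f(P) = Σ_{x,y} P(x,y)·f(P_X(x)·P_Y(y)/P(x,y))`. -/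
noncomputable def MIf {X Y : Type*} [Fintype X] [Fintype Y]
    (f : ℝ → ℝ) (P : X → Y → ℝ) : ℝ :=
  ∑ x, ∑ y, P x y * f ((∑ y', P x y') * (∑ x', P x' y) / P x y)

/-- A joint pmf `P` on `X × Y` is fine-grained if for every two distinct pairs
`(x,y) ≠ (x',y')` one has `P(x,y) > 0`, `P(x',y') > 0` and
`P_X(x)·P_Y(y)/P(x,y) ≠ P_X(x')·P_Y(y')/P(x',y')`. -/
def FineGrained {X Y : Type*} [Fintype X] [Fintype Y] (P : X → Y → ℝ) : Prop :=
  ∀ a b : X × Y, a ≠ b →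
    0 < P a.1 a.2 ∧ 0 < P b.1 b.2 ∧
      (∑ y', P a.1 y') * (∑ x', P x' a.2) / P a.1 a.2
        ≠ (∑ y', P b.1 y') * (∑ x', P x' b.2) / P b.1 b.2

/-- A square matrix is a permutation matrix if it is a 0/1 matrix with exactly
one 1 in each row and in each column. -/
def IsPermutationMatrix {X : Type*} [Fintype X] (M : X → X → ℝ) : Prop :=
  (∀ i j, M i j = 0 ∨ M i j = 1) ∧ (∀ i, ∃! j, M i j = 1) ∧ (∀ j, ∃! i, M i j = 1)

/-- Strict Jensen inequality in perspective form: for nonnegative masses `a` of positive total,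
two of which are positive and sit at different points. -/
lemma StrictConvexOn.sum_mul_map_div_lt {ι : Type*} [Fintype ι] {f : ℝ → ℝ}
    (hf : StrictConvexOn ℝ Set.univ f) {a r : ι → ℝ} (ha : ∀ i, 0 ≤ a i) {j k : ι}
    (hj : 0 < a j) (hk : 0 < a k) (hjk : r j ≠ r k) :
    (∑ i, a i) * f ((∑ i, a i * r i) / ∑ i, a i) < ∑ i, a i * f (r i) := by
  have hS : 0 < ∑ i, a i := Finset.sum_pos' (fun i _ => ha i) ⟨j, Finset.mem_univ j, hj⟩
  have h := (hf.map_sum_lt_iff_of_nonneg (t := Finset.univ) (w := fun i => a i / ∑ i, a i) (p := r)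
    (fun i _ => div_nonneg (ha i) hS.le) (by rw [← Finset.sum_div, div_self hS.ne'])
    (fun _ _ => Set.mem_univ _)).2 ⟨j, Finset.mem_univ j, k, Finset.mem_univ k,
      (div_pos hj hS).ne', (div_pos hk hS).ne', hjk⟩
  simp only [smul_eq_mul, div_mul_eq_mul_div, ← Finset.sum_div] at h
  rw [lt_div_iff₀ hS] at h
  linarith

/-- Jensen inequality in perspective form, for nonnegative masses `a` of positive total. -/
lemma ConvexOn.sum_mul_map_div_le {ι : Type*} [Fintype ι] {f : ℝ → ℝ}
    (hf : ConvexOn ℝ Set.univ f) {a r : ι → ℝ} (ha : ∀ i, 0 ≤ a i) (hS : 0 < ∑ i, a i) :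
    (∑ i, a i) * f ((∑ i, a i * r i) / ∑ i, a i) ≤ ∑ i, a i * f (r i) := by
  have h := hf.map_sum_le (t := Finset.univ) (w := fun i => a i / ∑ i, a i) (p := r)
    (fun i _ => div_nonneg (ha i) hS.le) (by rw [← Finset.sum_div, div_self hS.ne'])
    (fun _ _ => Set.mem_univ _)
  simp only [smul_eq_mul, div_mul_eq_mul_div, ← Finset.sum_div] at h
  rw [le_div_iff₀ hS] at h
  linarith

/-- A square transition matrix without zero columns that is not a permutation matrix has a column
with two positive entries. -/
lemma exists_column_two_pos_of_not_isPermutationMatrix {X : Type*} [Fintype X] {M : X → X → ℝ}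
    (hM_nonneg : ∀ x x', 0 ≤ M x x') (hM_rows : ∀ x, ∑ x', M x x' = 1)
    (hM_cols : ∀ x', ∃ x, 0 < M x x') (hM_notperm : ¬ IsPermutationMatrix M) :
    ∃ x' x₁ x₂, x₁ ≠ x₂ ∧ 0 < M x₁ x' ∧ 0 < M x₂ x' := by
  by_contra! hcon
  have huniq : ∀ x' x₁ x₂, 0 < M x₁ x' → 0 < M x₂ x' → x₁ = x₂ := fun x' x₁ x₂ h₁ h₂ => by
    by_contra h
    exact (hcon x' x₁ x₂ h h₁).not_gt h₂
  choose g hg using hM_cols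
  have hsurj : Function.Surjective g := fun x => by
    obtain ⟨x', -, hx'⟩ := Finset.exists_ne_zero_of_sum_ne_zero
      (show ∑ x', M x x' ≠ 0 by simp [hM_rows])
    exact ⟨x', huniq x' _ _ (hg x') ((hM_nonneg x x').lt_of_ne' hx')⟩
  have hinj : Function.Injective g := Finite.injective_iff_surjective.2 hsurj
  have hzero : ∀ x x', g x' ≠ x → M x x' = 0 := fun x x' h => by
    by_contra h0
    exact h (huniq x' _ _ (hg x') ((hM_nonneg x x').lt_of_ne' h0))
  have hone : ∀ x', M (g x') x' = 1 := fun x' => by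
    rw [← hM_rows (g x')]
    exact (Finset.sum_eq_single x' (fun b _ hb => hzero _ _ (hinj.ne hb)) (by simp)).symm
  have hiff : ∀ x x', M x x' = 1 ↔ g x' = x := fun x x' => by
    refine ⟨fun h => ?_, fun h => h ▸ hone x'⟩
    by_contra hne
    simp [hzero x x' hne] at h
  refine hM_notperm ⟨fun x x' => ?_, fun x => ?_, fun x' => ?_⟩
  · by_cases h : g x' = x
    · exact Or.inr ((hiff x x').2 h)
    · exact Or.inl (hzero x x' h)
  · simp only [hiff]
    exact (Function.Bijective.existsUnique ⟨hinj, hsurj⟩ x)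
  · simp only [hiff]
    exact existsUnique_eq'

/-- **Strict data processing inequality for f-mutual information.**
If `P` is a fine-grained joint pmf on `Σ_X × Σ_Y`, `M` a square transition matrix on
`Σ_X` that is not a permutation matrix, `f` strictly convex with `f 1 = 0`, and `P`,
the pushforward `M(P)` and all their marginals are strictly positive, then
`MI_f(M(P)) < MI_f(P)`. -/
theorem f_mutual_information_strict_data_processing
    {X Y : Type*} [Fintype X] [Fintype Y]
    (P : X → Y → ℝ)
    (hP_pos : ∀ x y, 0 < P x y)
    (hP_sum : ∑ x, ∑ y, P x y = 1)
    (hPX_pos : ∀ x, 0 < ∑ y, P x y)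
    (hPY_pos : ∀ y, 0 < ∑ x, P x y)
    (hP_fg : FineGrained P)
    (M : X → X → ℝ)
    (hM_nonneg : ∀ x x', 0 ≤ M x x')
    (hM_rows : ∀ x, ∑ x', M x x' = 1)
    (hM_notperm : ¬ IsPermutationMatrix M)
    (hMP_pos : ∀ x' y, 0 < ∑ x, M x x' * P x y)
    (hMPX_pos : ∀ x', 0 < ∑ y, ∑ x, M x x' * P x y)
    (hMPY_pos : ∀ y, 0 < ∑ x', ∑ x, M x x' * P x y)
    (f : ℝ → ℝ) (hf : StrictConvexOn ℝ Set.univ f) (hf1 : f 1 = 0) :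
    MIf f (fun x' y => ∑ x, M x x' * P x y) < MIf f P := by
  obtain ⟨y₀⟩ : Nonempty Y := by
    by_contra! h
    simp at hP_sum
  have hM_cols : ∀ x', ∃ x, 0 < M x x' := fun x' => by
    obtain ⟨x, -, hx⟩ := Finset.exists_ne_zero_of_sum_ne_zero (hMP_pos x' y₀).ne'
    exact ⟨x, (hM_nonneg x x').lt_of_ne' (left_ne_zero_of_mul hx)⟩
  obtain ⟨x', x₁, x₂, hne, h₁, h₂⟩ :=
    exists_column_two_pos_of_not_isPermutationMatrix hM_nonneg hM_rows hM_cols hM_notperm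
  let r : X → Y → ℝ := fun x y => (∑ y', P x y') * (∑ x', P x' y) / P x y
  have hr : r x₁ y₀ ≠ r x₂ y₀ := (hP_fg (x₁, y₀) (x₂, y₀) (by simpa using hne)).2.2
  have hmargY : ∀ y, ∑ x', ∑ x, M x x' * P x y = ∑ x, P x y := fun y => by
    rw [Finset.sum_comm]
    simp only [← Finset.sum_mul, hM_rows, one_mul]
  have hratio : ∀ x' y, (∑ y', ∑ x, M x x' * P x y') * (∑ x', ∑ x, M x x' * P x y)
      = ∑ x, M x x' * P x y * r x y := fun x' y => by
    rw [hmargY, Finset.sum_comm, Finset.sum_mul]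
    refine Finset.sum_congr rfl fun x _ => ?_
    have := (hP_pos x y).ne'
    simp only [r, ← Finset.mul_sum]
    field_simp
  have hnonneg : ∀ x' y x, 0 ≤ M x x' * P x y := fun x' y x =>
    mul_nonneg (hM_nonneg x x') (hP_pos x y).le
  have hle : ∀ x' y, (∑ x, M x x' * P x y)
      * f ((∑ x, M x x' * P x y * r x y) / ∑ x, M x x' * P x y)
      ≤ ∑ x, M x x' * P x y * f (r x y) := fun x' y =>
    hf.convexOn.sum_mul_map_div_le (hnonneg x' y) (hMP_pos x' y)
  have hlt := hf.sum_mul_map_div_lt (r := fun x => r x y₀) (hnonneg x' y₀)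
    (mul_pos h₁ (hP_pos x₁ y₀)) (mul_pos h₂ (hP_pos x₂ y₀)) hr
  calc MIf f (fun x' y => ∑ x, M x x' * P x y)
      = ∑ x', ∑ y, (∑ x, M x x' * P x y)
          * f ((∑ x, M x x' * P x y * r x y) / ∑ x, M x x' * P x y) := by
        simp only [MIf, hratio]
    _ < ∑ x', ∑ y, ∑ x, M x x' * P x y * f (r x y) :=
        Finset.sum_lt_sum (fun x' _ => Finset.sum_le_sum fun y _ => hle x' y)
          ⟨x', Finset.mem_univ _, Finset.sum_lt_sum (fun y _ => hle x' y)
            ⟨y₀, Finset.mem_univ _, hlt⟩⟩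
    _ = ∑ y, ∑ x, ∑ x', M x x' * P x y * f (r x y) := by
        rw [Finset.sum_comm]
        exact Finset.sum_congr rfl fun y _ => Finset.sum_comm
    _ = ∑ y, ∑ x, P x y * f (r x y) := by
        simp only [mul_assoc, ← Finset.sum_mul, hM_rows, one_mul]
    _ = MIf f P := Finset.sum_comm
end

section
/- Dominant truthfulness of the f-mutual information paradigm (Theorem 3.1 instantiated with f-mutual information, Corollary 3.8): Let n ≥ 2, let Σ and Σ' be finite sets, and let Q be a joint pmf on Σ^n (agent i's prior over the n agents' private signals), with pairwise marginals Q_{ij} on Σ × Σ. Let M₁, …, Mₙ be transition matrices from Σ to Σ' (the agents' reporting strategies), and for i ≠ j let P_{ij}^{(M_i, M_j)} denote the joint pmf of the reports (M_i(Ψ_i), M_j(Ψ_j)), i.e. P_{ij}^{(M_i,M_j)}(a,b) = Σ_{σ_i,σ_j} M_i(σ_i,a)·M_j(σ_j,b)·Q_{ij}(σ_i,σ_j). Let f : ℝ → ℝ be convex with f(1) = 0, and assume all the joint pmfs below and their marginals are strictly positive. Then for every agent i and every strategy M_i, Σ_{j≠i} MI_f( P_{ij}^{(M_i, M_j)} )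 ≤ Σ_{j≠i} MI_f( P_{ij}^{(Id, M_j)} ), where Id embeds Σ into Σ' via truthful reporting (a transition matrix that reports the received signal deterministically); that is, truth-telling maximizes agent i's expected information score no matter what strategies the other agents play. -/
/-- The pairwise marginal `Q_{ij}` of a joint pmf `Q` on `Σ^n`. -/
noncomputable def pairMarginal {n : ℕ} {S : Type*} [Fintype S] [DecidableEq S]
    (Q : (Fin n → S) → ℝ) (i j : Fin n) (a b : S) : ℝ :=
  ∑ v : Fin n → S, (if v i = a ∧ v j = b then Q v else 0)

/-- The joint pmf of the reports `(M_i(Ψ_i), M_j(Ψ_j))` when the pair of signals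
`(Ψ_i, Ψ_j)` has joint pmf `Qij` and agents `i, j` apply the reporting strategies
(transition matrices) `Mi, Mj`. -/
noncomputable def reportJoint {S S' : Type*} [Fintype S]
    (Qij : S → S → ℝ) (Mi Mj : S → S' → ℝ) (a b : S') : ℝ :=
  ∑ σi, ∑ σj, Mi σi a * Mj σj b * Qij σi σj

/-- The truthful reporting strategy: the deterministic (0/1) transition matrix
that reports the received signal, via the embedding `ι` of `Σ` into `Σ'`. -/
noncomputable def truthfulMat {S S' : Type*} [DecidableEq S'] (ι : S ↪ S') :
    S → S' → ℝ :=
  fun σ σ' => if σ' = ι σ then 1 else 0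

/-- Jensen's inequality for a convex function on `ℝ`, in perspective form. -/
theorem ConvexOn.sum_mul_map_div_le_s15 {ι : Type*} {s : Finset ι} {f : ℝ → ℝ}
    (hf : ConvexOn ℝ Set.univ f) {w c : ι → ℝ} (hw : ∀ x ∈ s, 0 ≤ w x) (hpos : 0 < ∑ x ∈ s, w x) :
    (∑ x ∈ s, w x) * f ((∑ x ∈ s, w x * c x) / ∑ x ∈ s, w x) ≤ ∑ x ∈ s, w x * f (c x) := by
  have h := hf.map_centerMass_le hw hpos (fun x _ => Set.mem_univ (c x))
  simp only [Finset.centerMass, smul_eq_mul, Function.comp_apply] at h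
  rw [div_eq_inv_mul]
  calc _ ≤ (∑ x ∈ s, w x) * ((∑ x ∈ s, w x)⁻¹ * ∑ x ∈ s, w x * f (c x)) :=
        mul_le_mul_of_nonneg_left h hpos.le
    _ = _ := mul_inv_cancel_left₀ hpos.ne' _

/-- Data processing inequality: applying a transition matrix to the first coordinate does not
increase the f-mutual information. -/
theorem MIf_le_of_transition {X Y Z : Type*} [Fintype X] [Fintype Y] [Fintype Z]
    {f : ℝ → ℝ} (hf : ConvexOn ℝ Set.univ f) {R : X → Y → ℝ} (hR : ∀ x y, 0 < R x y)
    {K : X → Z → ℝ} (hK : ∀ x z, 0 ≤ K x z) (hK_rows : ∀ x, ∑ z, K x z = 1)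
    (hP : ∀ z y, 0 < ∑ x, K x z * R x y) :
    MIf f (fun z y => ∑ x, K x z * R x y) ≤ MIf f R := by
  have marginal_snd (y : Y) : ∑ z, ∑ x, K x z * R x y = ∑ x, R x y := by
    rw [Finset.sum_comm]
    simp only [← Finset.sum_mul, hK_rows, one_mul]
  have marginal_fst (z : Z) : ∑ y, ∑ x, K x z * R x y = ∑ x, K x z * ∑ y, R x y := by
    rw [Finset.sum_comm]
    simp only [← Finset.mul_sum]
  unfold MIf
  calc _ ≤ ∑ z, ∑ y, ∑ x, K x z * R x y * f ((∑ y', R x y') * (∑ x', R x' y) / R x y) := by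
        refine Finset.sum_le_sum fun z _ => Finset.sum_le_sum fun y _ => ?_
        have hprod : (∑ x, K x z * ∑ y', R x y') * (∑ x, R x y) =
            ∑ x, K x z * R x y * ((∑ y', R x y') * (∑ x', R x' y) / R x y) := by
          rw [Finset.sum_mul]
          refine Finset.sum_congr rfl fun x _ => ?_
          have := (hR x y).ne'
          field_simp
        rw [marginal_fst, marginal_snd, hprod]
        exact hf.sum_mul_map_div_le_s15 (fun x _ => mul_nonneg (hK x z) (hR x y).le) (hP z y)
    _ = ∑ x, ∑ y, ∑ z, K x z * R x y * f ((∑ y', R x y') * (∑ x', R x' y) / R x y) := by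
        rw [Finset.sum_comm, Finset.sum_comm (s := (Finset.univ : Finset X))]
        exact Finset.sum_congr rfl fun y _ => Finset.sum_comm
    _ = _ := by
        refine Finset.sum_congr rfl fun x _ => Finset.sum_congr rfl fun y _ => ?_
        rw [← Finset.sum_mul, ← Finset.sum_mul, hK_rows, one_mul]

/-- The f-mutual information is invariant under relabelling the first coordinate. -/
theorem MIf_comp_equiv {X X' Y : Type*} [Fintype X] [Fintype X'] [Fintype Y]
    (f : ℝ → ℝ) (e : X ≃ X') (P : X' → Y → ℝ) :
    MIf f (fun x y => P (e x) y) = MIf f P := by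
  have marginal_snd (y : Y) : ∑ x, P (e x) y = ∑ x', P x' y := e.sum_comp fun x' => P x' y
  simp only [MIf, marginal_snd]
  exact e.sum_comp fun x => ∑ y, P x y * f ((∑ y', P x y') * (∑ x', P x' y) / P x y)

theorem reportJoint_eq_sum {S S' : Type*} [Fintype S] (q : S → S → ℝ) (A B : S → S' → ℝ)
    (a b : S') : reportJoint q A B a b = ∑ σ, A σ a * ∑ τ, B τ b * q σ τ := by
  simp only [reportJoint, Finset.mul_sum, mul_assoc]

theorem reportJoint_truthfulMat_apply {S S' : Type*} [Fintype S] [DecidableEq S']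
    (ι : S ↪ S') (q : S → S → ℝ) (B : S → S' → ℝ) (σ : S) (b : S') :
    reportJoint q (truthfulMat ι) B (ι σ) b = ∑ τ, B τ b * q σ τ := by
  classical
  simp [reportJoint_eq_sum, truthfulMat, ι.injective.eq_iff]

theorem reportJoint_truthfulMat_of_notMem_range {S S' : Type*} [Fintype S] [DecidableEq S']
    (ι : S ↪ S') (q : S → S → ℝ) (B : S → S' → ℝ) {a : S'} (ha : a ∉ Set.range ι) (b : S') :
    reportJoint q (truthfulMat ι) B a b = 0 := by
  rw [reportJoint_eq_sum]
  refine Finset.sum_eq_zero fun σ _ => ?_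
  rw [truthfulMat, if_neg fun h => ha ⟨σ, h.symm⟩, zero_mul]

/-- Truthful reporting yields at least the f-mutual information of any other strategy against a
fixed peer strategy. -/
theorem MIf_reportJoint_le_truthfulMat {S S' : Type*} [Fintype S] [Fintype S'] [DecidableEq S']
    {f : ℝ → ℝ} (hf : ConvexOn ℝ Set.univ f) (ι : S ↪ S') (q : S → S → ℝ) (A B : S → S' → ℝ)
    (hA : ∀ σ a, 0 ≤ A σ a) (hA_rows : ∀ σ, ∑ a, A σ a = 1)
    (hpos : ∀ a b, 0 < reportJoint q A B a b)
    (htru : ∀ a b, 0 < reportJoint q (truthfulMat ι) B a b) :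
    MIf f (reportJoint q A B) ≤ MIf f (reportJoint q (truthfulMat ι) B) := by
  have hι : Function.Bijective ι := by
    refine ⟨ι.injective, fun a => ?_⟩
    by_contra ha
    exact (htru a a).ne' (reportJoint_truthfulMat_of_notMem_range ι q B ha a)
  have htruthful : (fun σ b => reportJoint q (truthfulMat ι) B (Equiv.ofBijective ι hι σ) b) =
      fun σ b => ∑ τ, B τ b * q σ τ := by
    ext σ b
    exact reportJoint_truthfulMat_apply ι q B σ b
  have hreport : reportJoint q A B = fun a b => ∑ σ, A σ a * ∑ τ, B τ b * q σ τ := by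
    ext a b
    exact reportJoint_eq_sum q A B a b
  rw [← MIf_comp_equiv f (Equiv.ofBijective ι hι) (reportJoint q (truthfulMat ι) B), htruthful,
    hreport]
  refine MIf_le_of_transition hf (fun σ b => ?_) hA hA_rows fun a b => ?_
  · rw [← reportJoint_truthfulMat_apply ι q]
    exact htru _ _
  · rw [← reportJoint_eq_sum]
    exact hpos a b

/-- **Dominant truthfulness of the f-mutual information paradigm
(Theorem 3.1 with f-mutual information, Corollary 3.8).**
With `n ≥ 2` agents whose signals have joint prior `Q` on `Σ^n`, reporting
strategies `M₁,…,Mₙ` (transition matrices from `Σ` to `Σ'`), and a convex `f`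
with `f 1 = 0`, if all report-pair joint pmfs below and their marginals are
strictly positive, then truth-telling maximizes agent `i`'s expected information
score no matter what strategies the other agents play:
`Σ_{j≠i} MI_f(P_{ij}^{(M_i,M_j)}) ≤ Σ_{j≠i} MI_f(P_{ij}^{(Id,M_j)})`. -/
theorem f_mutual_information_paradigm_dominantly_truthful
    {n : ℕ} (hn : 2 ≤ n)
    {S S' : Type*} [Fintype S] [Fintype S'] [DecidableEq S] [DecidableEq S']
    (Q : (Fin n → S) → ℝ)
    (hQ_nonneg : ∀ v, 0 ≤ Q v)
    (hQ_sum : ∑ v, Q v = 1)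
    (M : Fin n → S → S' → ℝ)
    (hM_nonneg : ∀ k σ σ', 0 ≤ M k σ σ')
    (hM_rows : ∀ k σ, ∑ σ', M k σ σ' = 1)
    (ι : S ↪ S')
    (f : ℝ → ℝ) (hf : ConvexOn ℝ Set.univ f) (hf1 : f 1 = 0)
    (i : Fin n)
    (hrep_pos : ∀ j ∈ Finset.univ.erase i, ∀ a b : S',
      0 < reportJoint (pairMarginal Q i j) (M i) (M j) a b)
    (hrep_margX_pos : ∀ j ∈ Finset.univ.erase i, ∀ a : S',
      0 < ∑ b, reportJoint (pairMarginal Q i j) (M i) (M j) a b)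
    (hrep_margY_pos : ∀ j ∈ Finset.univ.erase i, ∀ b : S',
      0 < ∑ a, reportJoint (pairMarginal Q i j) (M i) (M j) a b)
    (htru_pos : ∀ j ∈ Finset.univ.erase i, ∀ a b : S',
      0 < reportJoint (pairMarginal Q i j) (truthfulMat ι) (M j) a b)
    (htru_margX_pos : ∀ j ∈ Finset.univ.erase i, ∀ a : S',
      0 < ∑ b, reportJoint (pairMarginal Q i j) (truthfulMat ι) (M j) a b)
    (htru_margY_pos : ∀ j ∈ Finset.univ.erase i, ∀ b : S',
      0 < ∑ a, reportJoint (pairMarginal Q i j) (truthfulMat ι) (M j) a b) :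
    ∑ j ∈ Finset.univ.erase i, MIf f (reportJoint (pairMarginal Q i j) (M i) (M j))
      ≤ ∑ j ∈ Finset.univ.erase i,
          MIf f (reportJoint (pairMarginal Q i j) (truthfulMat ι) (M j)) := by
  exact Finset.sum_le_sum fun j hj => MIf_reportJoint_le_truthfulMat hf ι _ _ _
    (hM_nonneg i) (hM_rows i) (hrep_pos j hj) (htru_pos j hj)
end
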